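/- For every λ ∈ (−1, 1) and every α > 0, the operator B(λ, α) on ℓ²(ℤ,ℂ) ⊕ ℓ²(ℤ,ℂ) is irreducible: the only closed subspaces of ℓ²(ℤ,ℂ) ⊕ ℓ²(ℤ,ℂ) that are invariant under both B(λ, α) and its adjoint are {0} and the whole space. -/

import Mathlib

noncomputable section

open ContinuousLinearMap

/-- The Hilbert space `ℓ²(ℤ, ℂ)`. -/
abbrev H : Type := lp (fun _ : ℤ => ℂ) 2

/-- The standard orthonormal basis vectors of `ℓ²(ℤ, ℂ)`. -/
def e (n : ℤ) : H := lp.single 2 n 1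

/-- The `2 × 2` upper-triangular block operator `[[T₁, S], [0, T₂]]` on the Hilbert space
direct sum `E ⊕ E = WithLp 2 (E × E)`. -/
def blockOp {E : Type*} [NormedAddCommGroup E] [NormedSpace ℂ E]
    (T₁ S T₂ : E →L[ℂ] E) : WithLp 2 (E × E) →L[ℂ] WithLp 2 (E × E) :=
  ((WithLp.prodContinuousLinearEquiv 2 ℂ E E).symm :
      E × E →L[ℂ] WithLp 2 (E × E)) ∘L
    ((((T₁ ∘L fst ℂ E E) + (S ∘L snd ℂ E E)).prod (T₂ ∘L snd ℂ E E)) ∘L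
      ((WithLp.prodContinuousLinearEquiv 2 ℂ E E) :
        WithLp 2 (E × E) →L[ℂ] E × E))

/-- Unitary equivalence of bounded operators on (possibly different) complex Hilbert spaces:
there is a unitary (= surjective linear isometry) `U` with `U A U⁻¹ = B`. -/
def UnitarilyEquiv {E F : Type*} [NormedAddCommGroup E] [NormedSpace ℂ E]
    [NormedAddCommGroup F] [NormedSpace ℂ F] (A : E →L[ℂ] E) (B : F →L[ℂ] F) : Prop :=
  ∃ U : E ≃ₗᵢ[ℂ] F, ∀ x, U (A x) = B (U x)

/-- The Möbius transform `e^{iθ} (T - c·1)(1 - c̄·T)⁻¹` of an operator. -/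
def mobius {E : Type*} [NormedAddCommGroup E] [NormedSpace ℂ E] [CompleteSpace E]
    (θ : ℝ) (c : ℂ) (T : E →L[ℂ] E) : E →L[ℂ] E :=
  Complex.exp (θ * Complex.I) •
    ((T - c • (1 : E →L[ℂ] E)) * Ring.inverse (1 - (starRingEnd ℂ c) • T))

/-- A bounded operator on a complex Hilbert space is homogeneous if its spectrum lies in the
closed unit disc and all its Möbius transforms are unitarily equivalent to it. -/
def Homogeneous {E : Type*} [NormedAddCommGroup E] [NormedSpace ℂ E] [CompleteSpace E]
    (T : E →L[ℂ] E) : Prop :=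
  spectrum ℂ T ⊆ Metric.closedBall 0 1 ∧
    ∀ (θ : ℝ) (c : ℂ), ‖c‖ < 1 →
      IsUnit (1 - (starRingEnd ℂ c) • T) ∧ UnitarilyEquiv (mobius θ c T) T

/-- A bounded operator is irreducible if the only closed subspaces invariant under both the
operator and its adjoint are `{0}` and the whole space. -/
def IrreducibleOp {E : Type*} [NormedAddCommGroup E] [InnerProductSpace ℂ E] [CompleteSpace E]
    (T : E →L[ℂ] E) : Prop :=
  ∀ M : Submodule ℂ E, IsClosed (M : Set E) → (∀ x ∈ M, T x ∈ M) →
    (∀ x ∈ M, ContinuousLinearMap.adjoint T x ∈ M) → M = ⊥ ∨ M = ⊤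

/-- Weight sequence of the shift `B_{λ, ia}`. -/
def wB (l a : ℝ) (n : ℤ) : ℂ :=
  ((n : ℂ) + (1 + (l : ℂ)) / 2 + Complex.I * (a : ℂ)) /
    ((n : ℂ) + (1 + (l : ℂ)) / 2 - Complex.I * (a : ℂ))

/-- Weight sequence of the shift `T(a, b)`. -/
def wT (a b : ℝ) (n : ℤ) : ℂ := (Real.sqrt (((n : ℝ) + a) / ((n : ℝ) + b)) : ℂ)

/-- Weight sequence of the shift `S[λ]`. -/
def wS (l : ℝ) (n : ℤ) : ℂ := ((l : ℂ) + 2 * (n : ℂ) + 1)⁻¹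

open scoped InnerProductSpace

/-- The basis vector `e n` in the first summand of `H ⊕ H`. -/
def e₁ (n : ℤ) : WithLp 2 (H × H) := WithLp.toLp 2 (e n, 0)

/-- The basis vector `e n` in the second summand of `H ⊕ H`. -/
def e₂ (n : ℤ) : WithLp 2 (H × H) := WithLp.toLp 2 (0, e n)

theorem inner_e_left (n : ℤ) (x : H) : ⟪e n, x⟫_ℂ = x n := by
  simp [e, lp.inner_single_left]

theorem e_apply (n m : ℤ) : e n m = if n = m then 1 else 0 := by
  simp [e, lp.single_apply, Pi.single_apply, eq_comm]

theorem inner_e₁_left (n : ℤ) (x : WithLp 2 (H × H)) : ⟪e₁ n, x⟫_ℂ = x.fst n := by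
  simp [e₁, WithLp.prod_inner_apply, inner_e_left]

theorem inner_e₂_left (n : ℤ) (x : WithLp 2 (H × H)) : ⟪e₂ n, x⟫_ℂ = x.snd n := by
  simp [e₂, WithLp.prod_inner_apply, inner_e_left]

theorem ext_inner_e₁_e₂ {x y : WithLp 2 (H × H)} (h₁ : ∀ n, ⟪e₁ n, x⟫_ℂ = ⟪e₁ n, y⟫_ℂ)
    (h₂ : ∀ n, ⟪e₂ n, x⟫_ℂ = ⟪e₂ n, y⟫_ℂ) : x = y := by
  simp only [inner_e₁_left, inner_e₂_left] at h₁ h₂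
  refine WithLp.ofLp_injective 2 (Prod.ext ?_ ?_)
  · ext n; exact h₁ n
  · ext n; exact h₂ n

theorem inner_e₁_e₁ (n m : ℤ) : ⟪e₁ n, e₁ m⟫_ℂ = if m = n then 1 else 0 := by
  rw [inner_e₁_left]; exact e_apply m n

theorem inner_e₁_e₂ (n m : ℤ) : ⟪e₁ n, e₂ m⟫_ℂ = 0 := by
  rw [inner_e₁_left]; rfl

theorem inner_e₂_e₁ (n m : ℤ) : ⟪e₂ n, e₁ m⟫_ℂ = 0 := by
  rw [inner_e₂_left]; rfl

theorem inner_e₂_e₂ (n m : ℤ) : ⟪e₂ n, e₂ m⟫_ℂ = if m = n then 1 else 0 := by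
  rw [inner_e₂_left]; exact e_apply m n

/-- The orthogonal projection onto a reducing subspace commutes with the operator. -/
theorem starProjection_apply_comm {E : Type*} [NormedAddCommGroup E] [InnerProductSpace ℂ E]
    [CompleteSpace E] {T : E →L[ℂ] E} {M : Submodule ℂ E} [M.HasOrthogonalProjection]
    (hT : ∀ x ∈ M, T x ∈ M) (hT' : ∀ x ∈ M, adjoint T x ∈ M) (x : E) :
    M.starProjection (T x) = T (M.starProjection x) := by
  refine Submodule.eq_starProjection_of_mem_orthogonal
    (hT _ (Submodule.starProjection_apply_mem _ _)) ?_
  rw [← map_sub, Submodule.mem_orthogonal]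
  intro y hy
  rw [← adjoint_inner_left]
  exact (Submodule.mem_orthogonal _ _).1 (Submodule.sub_starProjection_mem_orthogonal x) _
    (hT' y hy)

/-- The coefficient form of commuting with a weighted shift and its adjoint: the entries
`a, b, c, g` of a `2 × 2` block matrix satisfying the commutation relations vanish off the diagonal,
and on the diagonal form a fixed scalar matrix. -/
theorem coeff_eq_of_comm {a b c g : ℤ → ℤ → ℂ} {d : ℤ → ℝ}
    (hd : ∀ n, d n ≠ 0) (hd₀ : d 0 + d 1 ≠ 0)
    (hsep : ∀ n m, n ≠ m → d n ^ 2 ≠ d m ^ 2 ∨ d (n + 1) ^ 2 ≠ d (m + 1) ^ 2)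
    (r₁ : ∀ n m, a (n + 1) (m + 1) = a n m + d n * c n m)
    (r₂ : ∀ n m, c (n + 1) (m + 1) = c n m)
    (r₃ : ∀ n m, d m * a (n + 1) (m + 1) + b (n + 1) (m + 1) = b n m + d n * g n m)
    (r₄ : ∀ n m, d m * c (n + 1) (m + 1) + g (n + 1) (m + 1) = g n m)
    (r₅ : ∀ n m, a n m + d m * b n m = a (n + 1) (m + 1))
    (r₆ : ∀ n m, c n m + d m * g n m = d n * a (n + 1) (m + 1) + c (n + 1) (m + 1))
    (r₇ : ∀ n m, b n m = b (n + 1) (m + 1))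
    (r₈ : ∀ n m, g n m = d n * b (n + 1) (m + 1) + g (n + 1) (m + 1)) :
    (∀ n m, n ≠ m → a n m = 0 ∧ b n m = 0 ∧ c n m = 0 ∧ g n m = 0) ∧
      ∀ n, a n n = a 0 0 ∧ b n n = 0 ∧ c n n = 0 ∧ g n n = a 0 0 := by
  have hdC (n) : (d n : ℂ) ≠ 0 := by exact_mod_cast hd n
  have off_of_ne (n m) (h : d n ^ 2 ≠ d m ^ 2) :
      a n m = 0 ∧ b n m = 0 ∧ c n m = 0 ∧ g n m = 0 := by
    have hC : (d m : ℂ) ^ 2 - (d n : ℂ) ^ 2 ≠ 0 := sub_ne_zero.2 (by exact_mod_cast h.symm)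
    have hb : b n m = 0 := by
      refine (mul_eq_zero.1 (?_ : ((d m : ℂ) ^ 2 - (d n : ℂ) ^ 2) * b n m = 0)).resolve_left hC
      linear_combination d m * (r₁ n m + r₅ n m) +
        d n * (r₄ n m + r₈ n m - d m * r₂ n m - d n * r₇ n m)
    have ha : a (n + 1) (m + 1) = 0 := by
      refine (mul_eq_zero.1
        (?_ : ((d m : ℂ) ^ 2 - (d n : ℂ) ^ 2) * a (n + 1) (m + 1) = 0)).resolve_left hC
      linear_combination d m * (r₃ n m + r₇ n m) + d n * (r₆ n m + r₂ n m)
    have hc : c n m = 0 := by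
      refine (mul_eq_zero.1 (?_ : (d n : ℂ) * c n m = 0)).resolve_left (hdC n)
      linear_combination d m * hb - r₁ n m - r₅ n m
    have hg : g n m = 0 := by
      refine (mul_eq_zero.1 (?_ : (d m : ℂ) * g n m = 0)).resolve_left (hdC m)
      linear_combination r₆ n m + r₂ n m + d n * ha
    exact ⟨by linear_combination ha + r₅ n m - d m * hb, hb, hc, hg⟩
  have off (n m) (h : n ≠ m) : a n m = 0 ∧ b n m = 0 ∧ c n m = 0 ∧ g n m = 0 := by
    rcases hsep n m h with h | h
    · exact off_of_ne n m h
    · obtain ⟨ha, hb, hc, hg⟩ := off_of_ne _ _ h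
      have hc' : c n m = 0 := (r₂ n m).symm.trans hc
      exact ⟨by linear_combination ha - r₁ n m - d n * hc', (r₇ n m).trans hb, hc',
        by linear_combination r₈ n m + d n * hb + hg⟩
  have hb_const (n : ℤ) : b n n = b 0 0 := by
    induction n using Int.induction_on with
    | zero => rfl
    | succ n ih => rw [← ih, ← r₇]
    | pred n ih => rw [← ih, r₇ (-n - 1), sub_add_cancel]
  have hga (n) : g n n = a (n + 1) (n + 1) :=
    mul_left_cancel₀ (hdC n) (by linear_combination r₆ n n + r₂ n n)
  have hb₀ : b 0 0 = 0 := by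
    have hC : (d 0 + d 1 : ℂ) ≠ 0 := by exact_mod_cast hd₀
    refine (mul_eq_zero.1 (?_ : (d 0 + d 1 : ℂ) * b 0 0 = 0)).resolve_left hC
    have h₁ := r₈ 0 0
    have h₂ := hga 0
    simp only [zero_add] at h₁ h₂
    linear_combination r₅ 1 1 - h₁ + h₂ - hga 1 - (d 0 + d 1 : ℂ) * hb_const 1
  have hb (n) : b n n = 0 := (hb_const n).trans hb₀
  have hc (n) : c n n = 0 := by
    refine (mul_eq_zero.1 (?_ : (d n : ℂ) * c n n = 0)).resolve_left (hdC n)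
    linear_combination d n * hb n - r₁ n n - r₅ n n
  have ha_succ (n) : a (n + 1) (n + 1) = a n n := by
    rw [← r₅, hb, mul_zero, add_zero]
  have ha (n : ℤ) : a n n = a 0 0 := by
    induction n using Int.induction_on with
    | zero => rfl
    | succ n ih => rw [← ih, ha_succ]
    | pred n ih => rw [← ih, ← ha_succ (-n - 1), sub_add_cancel]
  exact ⟨off, fun n => ⟨ha n, hb n, hc n, (hga n).trans (ha _)⟩⟩

/-- An operator on `H ⊕ H` that commutes with the weighted shift
`e₁ n ↦ e₁ (n + 1)`, `e₂ n ↦ d n • e₁ (n + 1) + e₂ (n + 1)` and its adjoint is a scalar on the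
basis vectors, provided that the weights `d` separate the indices. -/
theorem exists_scalar_of_commute {T P : WithLp 2 (H × H) →L[ℂ] WithLp 2 (H × H)} {d : ℤ → ℝ}
    (hd : ∀ n, d n ≠ 0) (hd₀ : d 0 + d 1 ≠ 0)
    (hsep : ∀ n m, n ≠ m → d n ^ 2 ≠ d m ^ 2 ∨ d (n + 1) ^ 2 ≠ d (m + 1) ^ 2)
    (hT₁ : ∀ n, T (e₁ n) = e₁ (n + 1))
    (hT₂ : ∀ n, T (e₂ n) = (d n : ℂ) • e₁ (n + 1) + e₂ (n + 1))
    (hPT : ∀ x, P (T x) = T (P x)) (hPT' : ∀ x, P (adjoint T x) = adjoint T (P x)) :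
    ∃ p : ℂ, ∀ n, P (e₁ n) = p • e₁ n ∧ P (e₂ n) = p • e₂ n := by
  have hA₁ (n : ℤ) : adjoint T (e₁ (n + 1)) = e₁ n + (d n : ℂ) • e₂ n := by
    refine ext_inner_e₁_e₂ (fun m => ?_) (fun m => ?_)
    · simp [-WithLp.prod_inner_apply, -Complex.coe_smul, -inner_self_eq_norm_sq_to_K,
        adjoint_inner_right, hT₁, inner_e₁_e₁, inner_e₁_e₂]
    · rw [adjoint_inner_right, hT₂]
      by_cases h : n = m <;>
      simp [-WithLp.prod_inner_apply, -Complex.coe_smul, -inner_self_eq_norm_sq_to_K, h,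
        inner_add_left, inner_smul_left, inner_e₁_e₁,
        inner_e₂_e₁, inner_e₂_e₂]
  have hA₂ (n : ℤ) : adjoint T (e₂ (n + 1)) = e₂ n := by
    refine ext_inner_e₁_e₂ (fun m => ?_) (fun m => ?_)
    · simp [-WithLp.prod_inner_apply, -Complex.coe_smul, -inner_self_eq_norm_sq_to_K,
        adjoint_inner_right, hT₁, inner_e₁_e₂]
    · rw [adjoint_inner_right, hT₂]
      simp [-WithLp.prod_inner_apply, -Complex.coe_smul, -inner_self_eq_norm_sq_to_K,
        inner_add_left, inner_smul_left, inner_e₁_e₂, inner_e₂_e₂]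
  let a (n m : ℤ) : ℂ := ⟪e₁ n, P (e₁ m)⟫_ℂ
  let b (n m : ℤ) : ℂ := ⟪e₁ n, P (e₂ m)⟫_ℂ
  let c (n m : ℤ) : ℂ := ⟪e₂ n, P (e₁ m)⟫_ℂ
  let g (n m : ℤ) : ℂ := ⟪e₂ n, P (e₂ m)⟫_ℂ
  have comm (x y) : ⟪x, P (T y)⟫_ℂ = ⟪adjoint T x, P y⟫_ℂ := by
    rw [hPT, adjoint_inner_left]
  have comm' (x y) : ⟪x, P (adjoint T y)⟫_ℂ = ⟪T x, P y⟫_ℂ := by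
    rw [hPT', adjoint_inner_right]
  have r₁ (n m) : a (n + 1) (m + 1) = a n m + d n * c n m := by
    simpa [-WithLp.prod_inner_apply, -Complex.coe_smul, a, b, c, g, mul_comm, hT₁, hA₁,
      inner_add_left, inner_smul_left] using comm (e₁ (n + 1)) (e₁ m)
  have r₂ (n m) : c (n + 1) (m + 1) = c n m := by
    simpa [-WithLp.prod_inner_apply, -Complex.coe_smul, a, b, c, g, mul_comm, hT₁, hA₂]
      using comm (e₂ (n + 1)) (e₁ m)
  have r₃ (n m) : d m * a (n + 1) (m + 1) + b (n + 1) (m + 1) = b n m + d n * g n m := by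
    simpa [-WithLp.prod_inner_apply, -Complex.coe_smul, a, b, c, g, mul_comm, hT₂, hA₁,
      inner_add_left, inner_smul_left, inner_add_right, inner_smul_right]
      using comm (e₁ (n + 1)) (e₂ m)
  have r₄ (n m) : d m * c (n + 1) (m + 1) + g (n + 1) (m + 1) = g n m := by
    simpa [-WithLp.prod_inner_apply, -Complex.coe_smul, a, b, c, g, mul_comm, hT₂, hA₂,
      inner_add_right, inner_smul_right] using comm (e₂ (n + 1)) (e₂ m)
  have r₅ (n m) : a n m + d m * b n m = a (n + 1) (m + 1) := by
    simpa [-WithLp.prod_inner_apply, -Complex.coe_smul, a, b, c, g, mul_comm, hT₁, hA₁,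
      inner_add_right, inner_smul_right] using comm' (e₁ n) (e₁ (m + 1))
  have r₆ (n m) : c n m + d m * g n m = d n * a (n + 1) (m + 1) + c (n + 1) (m + 1) := by
    simpa [-WithLp.prod_inner_apply, -Complex.coe_smul, a, b, c, g, mul_comm, hT₂, hA₁,
      inner_add_left, inner_smul_left, inner_add_right, inner_smul_right]
      using comm' (e₂ n) (e₁ (m + 1))
  have r₇ (n m) : b n m = b (n + 1) (m + 1) := by
    simpa [-WithLp.prod_inner_apply, -Complex.coe_smul, a, b, c, g, mul_comm, hT₁, hA₂]
      using comm' (e₁ n) (e₂ (m + 1))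
  have r₈ (n m) : g n m = d n * b (n + 1) (m + 1) + g (n + 1) (m + 1) := by
    simpa [-WithLp.prod_inner_apply, -Complex.coe_smul, a, b, c, g, mul_comm, hT₂, hA₂,
      inner_add_left, inner_smul_left] using comm' (e₂ n) (e₂ (m + 1))
  obtain ⟨off, diag⟩ := coeff_eq_of_comm hd hd₀ hsep r₁ r₂ r₃ r₄ r₅ r₆ r₇ r₈
  refine ⟨a 0 0, fun n => ⟨ext_inner_e₁_e₂ (fun m => ?_) (fun m => ?_),
    ext_inner_e₁_e₂ (fun m => ?_) (fun m => ?_)⟩⟩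
  · change a m n = _
    by_cases h : n = m
    · simp [-WithLp.prod_inner_apply, -inner_self_eq_norm_sq_to_K, inner_e₁_e₁, h, (diag m).1]
    · simp [-WithLp.prod_inner_apply, -inner_self_eq_norm_sq_to_K, inner_e₁_e₁, h,
        (off m n (Ne.symm h)).1]
  · change c m n = _
    by_cases h : n = m
    · simp [-WithLp.prod_inner_apply, -inner_self_eq_norm_sq_to_K, inner_e₂_e₁, h, (diag m).2.2.1]
    · simp [-WithLp.prod_inner_apply, -inner_self_eq_norm_sq_to_K, inner_e₂_e₁,
        (off m n (Ne.symm h)).2.2.1]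
  · change b m n = _
    by_cases h : n = m
    · simp [-WithLp.prod_inner_apply, -inner_self_eq_norm_sq_to_K, inner_e₁_e₂, h, (diag m).2.1]
    · simp [-WithLp.prod_inner_apply, -inner_self_eq_norm_sq_to_K, inner_e₁_e₂,
        (off m n (Ne.symm h)).2.1]
  · change g m n = _
    by_cases h : n = m
    · simp [-WithLp.prod_inner_apply, -inner_self_eq_norm_sq_to_K, inner_e₂_e₂, h, (diag m).2.2.2]
    · simp [-WithLp.prod_inner_apply, -inner_self_eq_norm_sq_to_K, inner_e₂_e₂, h,
        (off m n (Ne.symm h)).2.2.2]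

/-- A subspace whose orthogonal projection is a scalar on the basis vectors is trivial. -/
theorem eq_bot_or_eq_top_of_starProjection {M : Submodule ℂ (WithLp 2 (H × H))}
    [M.HasOrthogonalProjection] {p : ℂ}
    (hp : ∀ n, M.starProjection (e₁ n) = p • e₁ n ∧ M.starProjection (e₂ n) = p • e₂ n) :
    M = ⊥ ∨ M = ⊤ := by
  have hP (x) : M.starProjection x = starRingEnd ℂ p • x :=
    ext_inner_e₁_e₂
      (fun n => by
        rw [← Submodule.inner_starProjection_left_eq_right, (hp n).1, inner_smul_left,
          inner_smul_right])
      (fun n => by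
        rw [← Submodule.inner_starProjection_left_eq_right, (hp n).2, inner_smul_left,
          inner_smul_right])
  rcases eq_or_ne (starRingEnd ℂ p) 0 with h | h
  · refine Or.inl ((Submodule.eq_bot_iff _).2 fun x hx => ?_)
    rw [← Submodule.starProjection_eq_self_iff.2 hx, hP, h, zero_smul]
  · refine Or.inr ((Submodule.eq_top_iff').2 fun x => ?_)
    rw [← M.smul_mem_iff h, ← hP]
    exact Submodule.starProjection_apply_mem _ _

theorem add_two_mul_add_one_ne_zero {l : ℝ} (hl : -1 < l ∧ l < 1) (n : ℤ) :
    l + 2 * n + 1 ≠ 0 := by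
  intro h
  have h₁ : (-1 : ℝ) < 2 * n + 1 := by linarith
  have h₂ : (2 * n + 1 : ℝ) < 1 := by linarith
  have h₁' : (-1 : ℤ) < 2 * n + 1 := by exact_mod_cast h₁
  have h₂' : (2 * n + 1 : ℤ) < 1 := by exact_mod_cast h₂
  omega

theorem add_add_one_eq_zero_of_sq_eq {l α : ℝ} (hα : 0 < α) {n m : ℤ} (hnm : n ≠ m)
    (h : (α * (l + 2 * n + 1)⁻¹) ^ 2 = (α * (l + 2 * m + 1)⁻¹) ^ 2) : l + n + m + 1 = 0 := by
  rw [mul_pow, mul_pow, inv_pow, inv_pow] at h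
  have h := inv_injective (mul_left_cancel₀ (pow_ne_zero 2 hα.ne') h)
  rcases sq_eq_sq_iff_eq_or_eq_neg.1 h with h | h
  · exact absurd (by exact_mod_cast (by linarith : (n : ℝ) = m)) hnm
  · linarith

/-- the operator `B(λ, α)` is irreducible. -/
theorem stmt8 (l α : ℝ) (hl : -1 < l ∧ l < 1) (hα : 0 < α)
    (B₀ Sl : H →L[ℂ] H)
    (hB₀ : ∀ n : ℤ, B₀ (e n) = e (n + 1))
    (hSl : ∀ n : ℤ, Sl (e n) = wS l n • e (n + 1)) :
    IrreducibleOp (blockOp B₀ ((α : ℂ) • Sl) B₀) := by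
  let d (n : ℤ) : ℝ := α * (l + 2 * n + 1)⁻¹
  have hs := add_two_mul_add_one_ne_zero hl
  have hd (n : ℤ) : d n ≠ 0 := mul_ne_zero hα.ne' (inv_ne_zero (hs n))
  have hd₀ : d 0 + d 1 ≠ 0 := by
    have h₀ : 0 < l + 2 * (0 : ℤ) + 1 := by push_cast; linarith
    have h₁ : 0 < l + 2 * (1 : ℤ) + 1 := by push_cast; linarith
    exact (add_pos (mul_pos hα (inv_pos.2 h₀)) (mul_pos hα (inv_pos.2 h₁))).ne'
  have hsep (n m : ℤ) (hnm : n ≠ m) :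
      d n ^ 2 ≠ d m ^ 2 ∨ d (n + 1) ^ 2 ≠ d (m + 1) ^ 2 := by
    by_contra! h
    have h₁ := add_add_one_eq_zero_of_sq_eq hα hnm h.1
    have h₂ := add_add_one_eq_zero_of_sq_eq hα (by omega : n + 1 ≠ m + 1) h.2
    push_cast at h₂
    linarith
  intro M hM hT hT'
  have : CompleteSpace M := hM.completeSpace_coe
  obtain ⟨p, hp⟩ := exists_scalar_of_commute (P := M.starProjection) hd hd₀ hsep
    (fun n => by simp [blockOp, e₁, hB₀])
    (fun n => by
      refine WithLp.ofLp_injective 2 (Prod.ext ?_ ?_) <;>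
      simp [-Complex.coe_smul, blockOp, e₁, e₂, hB₀, hSl, wS, d, smul_smul])
    (starProjection_apply_comm hT hT')
    (starProjection_apply_comm hT' (by simpa using hT))
  exact eq_bot_or_eq_top_of_starProjection hp
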